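/- arXiv:2302.07956 — 2 statements merged into one kernel-verified Lean document; each statement's English description precedes it below -/
import Mathlib

section
/- Let σ > 0, n ∈ ℕ, v ∈ ℝⁿ, and let P be the product measure on ℝⁿ whose i-th factor is N(0, σ²) and Q the product measure whose i-th factor is N(v_i, σ²). Then every rejection rule φ : ℝⁿ → [0,1] with type I error α = ∫ φ dP satisfying α ∈ (0,1) has type II error β = 1 − ∫ φ dQ satisfying β ≥ Φ(Φ⁻¹(1 − α) − ‖v‖₂/σ), where ‖v‖₂ = (∑_i v_i²)^{1/2}; that is, the composed Gaussian mechanism satisfies (‖v‖₂/σ)-Gaussian differential privacy. -/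
open MeasureTheory ProbabilityTheory Real

/-- The standard normal cumulative distribution function `Φ`. -/
noncomputable def Phi (x : ℝ) : ℝ := ((gaussianReal 0 1) (Set.Iic x)).toReal

/-- The inverse `Φ⁻¹` of the standard normal CDF (on `(0,1)`). -/
noncomputable def PhiInv : ℝ → ℝ := Function.invFun Phi

lemma pi_gaussianReal_map_sum {ι : Type*} [Fintype ι] (m a : ι → ℝ) (w s : NNReal)
    (hs : (s : ℝ) = w * ∑ i, a i ^ 2) :
    (Measure.pi fun i => gaussianReal (m i) w).map (fun x => ∑ i, a i * x i) =
      gaussianReal (∑ i, a i * m i) s := by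
  have hmeas : Measurable fun x : ι → ℝ => ∑ i, a i * x i := by fun_prop
  have : IsProbabilityMeasure
      ((Measure.pi fun i => gaussianReal (m i) w).map (fun x => ∑ i, a i * x i)) :=
    Measure.isProbabilityMeasure_map hmeas.aemeasurable
  refine Measure.ext_of_charFun (funext fun t => ?_)
  rw [charFun_gaussianReal, charFun_apply_real, integral_map hmeas.aemeasurable (by fun_prop)]
  have h1 (x : ι → ℝ) : Complex.exp (t * ((∑ i, a i * x i : ℝ) : ℂ) * Complex.I) =
      ∏ i, Complex.exp (((t * a i : ℝ) : ℂ) * (x i : ℂ) * Complex.I) := by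
    rw [← Complex.exp_sum]
    congr 1
    push_cast
    rw [Finset.mul_sum, Finset.sum_mul]
    exact Finset.sum_congr rfl fun i _ => by ring
  simp_rw [h1]
  rw [integral_fintype_prod_eq_prod
    (f := fun i (x : ℝ) => Complex.exp (((t * a i : ℝ) : ℂ) * (x : ℂ) * Complex.I))]
  simp_rw [← charFun_apply_real, charFun_gaussianReal]
  rw [← Complex.exp_sum]
  congr 1
  have hs' : ((s : ℝ) : ℂ) = w * ∑ i, (a i : ℂ) ^ 2 := by
    rw [hs]; push_cast; rfl
  rw [hs']
  push_cast
  rw [Finset.sum_sub_distrib, Finset.mul_sum, Finset.sum_mul, Finset.mul_sum, Finset.sum_mul,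
    Finset.sum_div]
  congr 1 <;> exact Finset.sum_congr rfl fun i _ => by ring

lemma gaussianReal_eq_withDensity (m : ℝ) {w : NNReal} (hw : w ≠ 0) :
    gaussianReal m w = (gaussianReal 0 w).withDensity
      (fun x => ENNReal.ofReal (Real.exp ((m * x - m ^ 2 / 2) / w))) := by
  rw [gaussianReal_of_var_ne_zero _ hw, gaussianReal_of_var_ne_zero _ hw,
    ← withDensity_mul _ (measurable_gaussianPDF _ _) (by fun_prop)]
  congr 1
  ext x
  have hw' : (w : ℝ) ≠ 0 := by exact_mod_cast hw
  simp only [Pi.mul_apply, gaussianPDF, gaussianPDFReal]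
  rw [← ENNReal.ofReal_mul (by positivity), mul_assoc _ (Real.exp _), ← Real.exp_add]
  congr 3
  field_simp
  ring

lemma pi_withDensity {ι : Type*} [Fintype ι] {X : ι → Type*} [∀ i, MeasurableSpace (X i)]
    (μ : ∀ i, Measure (X i)) [∀ i, IsProbabilityMeasure (μ i)] {f : ∀ i, X i → ENNReal}
    (hf : ∀ i, Measurable (f i)) [∀ i, SigmaFinite ((μ i).withDensity (f i))] :
    Measure.pi (fun i => (μ i).withDensity (f i)) =
      (Measure.pi μ).withDensity (fun x => ∏ i, f i (x i)) := by
  refine Measure.pi_eq fun s hs => ?_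
  have hms := MeasurableSet.univ_pi hs
  have hg (i : ι) : Measurable ((s i).indicator (f i)) := (hf i).indicator (hs i)
  rw [withDensity_apply _ hms, ← lintegral_indicator hms]
  have h1 : (Set.univ.pi s).indicator (fun x => ∏ i, f i (x i)) =
      fun x => ∏ i, (s i).indicator (f i) (x i) := by
    ext x
    by_cases hx : x ∈ Set.univ.pi s
    · rw [Set.indicator_of_mem hx]
      exact Finset.prod_congr rfl fun i _ => by rw [Set.indicator_of_mem (hx i trivial)]
    · rw [Set.indicator_of_notMem hx]
      simp only [Set.mem_pi, Set.mem_univ, true_imp_iff, not_forall] at hx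
      obtain ⟨i, hi⟩ := hx
      exact (Finset.prod_eq_zero (Finset.mem_univ i) (Set.indicator_of_notMem hi _)).symm
  rw [h1, lintegral_prod_eq_prod_lintegral_of_indepFun Finset.univ
    (fun i (x : ∀ i, X i) => (s i).indicator (f i) (x i))
    (iIndepFun_pi fun i => (hg i).aemeasurable)
    (fun i => (hg i).comp (measurable_pi_apply i))]
  refine Finset.prod_congr rfl fun i _ => ?_
  rw [(measurePreserving_eval μ i).lintegral_comp (hg i), lintegral_indicator (hs i),
    withDensity_apply _ (hs i)]

/-- The Neyman–Pearson lemma. -/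
lemma neyman_pearson {Ω : Type*} [MeasurableSpace Ω] {P Q : Measure Ω} [IsProbabilityMeasure P]
    [IsProbabilityMeasure Q] {L : Ω → ℝ} (hL : Measurable L) (hL0 : ∀ x, 0 ≤ L x)
    (hQ : Q = P.withDensity fun x => ENNReal.ofReal (L x)) {φ : Ω → ℝ} (hφ : Measurable φ)
    (hφ01 : ∀ x, φ x ∈ Set.Icc (0 : ℝ) 1) {E : Set Ω} (hE : MeasurableSet E) {c : ℝ} (hc : 0 ≤ c)
    (hin : ∀ x ∈ E, c ≤ L x) (hout : ∀ x ∉ E, L x ≤ c) (h : ∫ x, φ x ∂P ≤ P.real E) :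
    ∫ x, φ x ∂Q ≤ Q.real E := by
  have hbdd : ∀ x, ‖φ x‖ ≤ 1 := fun x => by
    rw [Real.norm_of_nonneg (hφ01 x).1]; exact (hφ01 x).2
  have hLint : Integrable L P := by
    refine ⟨hL.aestronglyMeasurable, ?_⟩
    rw [hasFiniteIntegral_iff_ofReal (ae_of_all _ hL0)]
    have h1 : Q Set.univ = ∫⁻ x, ENNReal.ofReal (L x) ∂P := by
      rw [hQ, withDensity_apply _ MeasurableSet.univ, setLIntegral_univ]
    rw [← h1]
    exact measure_lt_top _ _
  have hφP : Integrable φ P := .of_bound hφ.aestronglyMeasurable 1 (ae_of_all _ hbdd)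
  have hLφ : Integrable (fun x => L x * φ x) P :=
    hLint.mul_bdd hφ.aestronglyMeasurable (ae_of_all _ hbdd)
  have hφQ : ∫ x, φ x ∂Q = ∫ x, L x * φ x ∂P := by
    rw [hQ, integral_withDensity_eq_integral_toReal_smul (by fun_prop) (by simp)]
    simp [ENNReal.toReal_ofReal (hL0 _)]
  have hEQ : Q.real E = ∫ x, E.indicator L x ∂P := by
    rw [integral_indicator hE, measureReal_def, hQ, withDensity_apply _ hE,
      integral_eq_lintegral_of_nonneg_ae (ae_of_all _ hL0) hL.aestronglyMeasurable]
  have hEP : P.real E = ∫ x, E.indicator 1 x ∂P := (integral_indicator_one hE).symm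
  have hone : Integrable (E.indicator (1 : Ω → ℝ)) P := (integrable_const (1 : ℝ)).indicator hE
  have key : ∫ x, (L x * φ x - c * φ x) ∂P ≤
      ∫ x, (E.indicator L x - c * E.indicator 1 x) ∂P := by
    refine integral_mono (hLφ.sub (hφP.const_mul c))
      ((hLint.indicator hE).sub (hone.const_mul c)) fun x => ?_
    obtain ⟨h0, h1⟩ := hφ01 x
    by_cases hx : x ∈ E
    · have := hin x hx
      simp only [Set.indicator_of_mem hx, Pi.one_apply]
      nlinarith
    · have := hout x hx
      simp only [Set.indicator_of_notMem hx]
      nlinarith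
  rw [integral_sub hLφ (hφP.const_mul c),
    integral_sub (hLint.indicator hE) (hone.const_mul c), integral_const_mul, integral_const_mul,
    ← hφQ, ← hEQ, ← hEP] at key
  nlinarith

lemma Phi_eq_cdf : Phi = cdf (gaussianReal 0 1) := by
  ext x
  rw [cdf_eq_real]
  rfl

lemma continuous_Phi : Continuous Phi := by
  have : NullSingletonClass (gaussianReal 0 1) := nullSingletonClass_gaussianReal one_ne_zero
  rw [continuous_iff_continuousAt]
  intro x
  rw [Phi_eq_cdf, (monotone_cdf _).continuousAt_iff_leftLim_eq_rightLim,
    StieltjesFunction.rightLim_eq]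
  have h := StieltjesFunction.measure_singleton (cdf (gaussianReal 0 1)) x
  rw [measure_cdf, measure_singleton] at h
  have h2 := ENNReal.ofReal_eq_zero.1 h.symm
  exact le_antisymm ((monotone_cdf _).leftLim_le le_rfl) (by linarith)

lemma Phi_PhiInv {y : ℝ} (hy : y ∈ Set.Ioo (0 : ℝ) 1) : Phi (PhiInv y) = y := by
  refine Function.invFun_eq (mem_range_of_exists_le_of_exists_ge continuous_Phi ?_ ?_)
  · rw [Phi_eq_cdf]
    exact (((tendsto_cdf_atBot _).eventually_lt_const hy.1).exists).imp fun _ h => h.le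
  · rw [Phi_eq_cdf]
    exact (((tendsto_cdf_atTop _).eventually_const_lt hy.2).exists).imp fun _ h => h.le

lemma gaussianReal_real_Iic (m t : ℝ) : (gaussianReal m 1).real (Set.Iic t) = Phi (t - m) := by
  have h := gaussianReal_map_sub_const (μ := m) (v := 1) m
  rw [sub_self] at h
  rw [Phi, ← h, Measure.map_apply (by fun_prop) measurableSet_Iic, measureReal_def]
  congr 2
  ext x
  simp

lemma pi_gaussianReal_typeII_error_ge (σ : ℝ) (hσ : 0 < σ) {w : NNReal} (hwσ : (w : ℝ) = σ ^ 2)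
    (n : ℕ) (v : Fin n → ℝ) (φ : (Fin n → ℝ) → ℝ) (hφ : Measurable φ) (hφ01 : ∀ x, φ x ∈ Set.Icc (0 : ℝ) 1)
    (hα : (∫ x, φ x ∂(Measure.pi fun _ : Fin n => gaussianReal 0 w))
      ∈ Set.Ioo (0 : ℝ) 1) :
    1 - ∫ x, φ x ∂(Measure.pi fun i : Fin n => gaussianReal (v i) w) ≥
      Phi (PhiInv
        (1 - ∫ x, φ x ∂(Measure.pi fun _ : Fin n => gaussianReal 0 w))
        - Real.sqrt (∑ i, (v i) ^ 2) / σ) := by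
  set P : Measure (Fin n → ℝ) := Measure.pi fun _ : Fin n => gaussianReal 0 w with hP
  set Q : Measure (Fin n → ℝ) :=
    Measure.pi fun i : Fin n => gaussianReal (v i) w with hQ
  have hα' : 1 - ∫ x, φ x ∂P ∈ Set.Ioo (0 : ℝ) 1 := ⟨by linarith [hα.2], by linarith [hα.1]⟩
  set t := PhiInv (1 - ∫ x, φ x ∂P)
  have hPhit : Phi t = 1 - ∫ x, φ x ∂P := Phi_PhiInv hα'
  set r := Real.sqrt (∑ i, (v i) ^ 2)
  have hr2 : r ^ 2 = ∑ i, (v i) ^ 2 := Real.sq_sqrt (Finset.sum_nonneg fun i _ => sq_nonneg _)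
  have hr_nonneg : 0 ≤ r := Real.sqrt_nonneg _
  have : IsProbabilityMeasure P := by rw [hP]; infer_instance
  have : IsProbabilityMeasure Q := by rw [hQ]; infer_instance
  rcases hr_nonneg.eq_or_lt with hr0 | hr0
  · have hv : v = 0 := by
      rw [← hr0, zero_pow two_ne_zero, eq_comm,
        Finset.sum_eq_zero_iff_of_nonneg fun i _ => sq_nonneg _] at hr2
      exact funext fun i => pow_eq_zero_iff two_ne_zero |>.1 (hr2 i (Finset.mem_univ i))
    have hQP : Q = P := by rw [hQ, hP, hv]; rfl
    rw [hQP, ← hr0, zero_div, sub_zero, hPhit]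
  have hw : w ≠ 0 := by
    rw [← NNReal.coe_ne_zero, hwσ]
    positivity
  set T : (Fin n → ℝ) → ℝ := fun x => ∑ i, v i / (σ * r) * x i with hT
  have hTm : Measurable T := by fun_prop
  have hs : ((1 : NNReal) : ℝ) =
      w * ∑ i, (v i / (σ * r)) ^ 2 := by
    simp_rw [div_pow]
    rw [← Finset.sum_div, ← hr2, hwσ, NNReal.coe_one]
    field_simp
  have hPT : P.map T = gaussianReal 0 1 := by
    have := pi_gaussianReal_map_sum (fun _ => 0) (fun i => v i / (σ * r)) _ 1 hs
    simpa using this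
  have hQT : Q.map T = gaussianReal (r / σ) 1 := by
    have := pi_gaussianReal_map_sum v (fun i => v i / (σ * r)) _ 1 hs
    have h2 : ∑ i, v i / (σ * r) * v i = r / σ := by
      rw [show ∑ i, v i / (σ * r) * v i = (∑ i, v i ^ 2) / (σ * r) by
        rw [Finset.sum_div]; exact Finset.sum_congr rfl fun i _ => by ring, ← hr2]
      field_simp
    rwa [h2] at this
  have hE : MeasurableSet (T ⁻¹' Set.Iic t) := hTm measurableSet_Iic
  have hPE : P.real (T ⁻¹' Set.Iic t)ᶜ = ∫ x, φ x ∂P := by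
    rw [probReal_compl_eq_one_sub hE, ← map_measureReal_apply hTm measurableSet_Iic, hPT,
      gaussianReal_real_Iic, sub_zero, hPhit, sub_sub_cancel]
  have hQE : Q.real (T ⁻¹' Set.Iic t)ᶜ = 1 - Phi (t - r / σ) := by
    rw [probReal_compl_eq_one_sub hE, ← map_measureReal_apply hTm measurableSet_Iic, hQT,
      gaussianReal_real_Iic]
  have hdens : Q = P.withDensity
      fun x => ENNReal.ofReal (Real.exp (r / σ * T x - (r / σ) ^ 2 / 2)) := by
    have heq := fun i => gaussianReal_eq_withDensity (v i) hw
    have (i : Fin n) : SigmaFinite ((gaussianReal 0 w).withDensity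
        fun x => ENNReal.ofReal (Real.exp ((v i * x - v i ^ 2 / 2) /
          w))) := by
      rw [← heq i]; infer_instance
    rw [hQ]
    simp_rw [heq]
    rw [pi_withDensity _ (fun i => by fun_prop)]
    congr 1
    ext x
    rw [← ENNReal.ofReal_prod_of_nonneg fun i _ => (Real.exp_pos _).le, ← Real.exp_sum]
    congr 2
    rw [hwσ, ← Finset.sum_div, Finset.sum_sub_distrib, ← Finset.sum_div, ← hr2, hT]
    simp only [div_mul_eq_mul_div]
    rw [← Finset.sum_div]
    field_simp
  have hNP := neyman_pearson (by fun_prop) (fun x => (Real.exp_pos _).le) hdens hφ hφ01 hE.compl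
    (Real.exp_pos (r / σ * t - (r / σ) ^ 2 / 2)).le
    (fun x hx => by
      have : t < T x := by simpa using hx
      gcongr)
    (fun x hx => by
      have : T x ≤ t := by simpa using hx
      gcongr)
    hPE.ge
  rw [hQE] at hNP
  linarith

/-- Let `P` be the product of `n` copies of `N(0, σ²)` and `Q` the product of
`N(v_i, σ²)`. Every rejection rule `φ : ℝⁿ → [0,1]` with type I error `α ∈ (0,1)` has type II
error at least `Φ(Φ⁻¹(1 - α) - ‖v‖₂/σ)`; i.e. the composed Gaussian mechanism satisfies
`(‖v‖₂/σ)`-Gaussian differential privacy. -/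
theorem stmt_6 (σ : ℝ) (hσ : 0 < σ) (n : ℕ) (v : Fin n → ℝ)
    (φ : (Fin n → ℝ) → ℝ) (hφ : Measurable φ) (hφ01 : ∀ x, φ x ∈ Set.Icc (0 : ℝ) 1)
    (hα : (∫ x, φ x ∂(Measure.pi fun _ : Fin n => gaussianReal 0 ⟨σ ^ 2, sq_nonneg σ⟩))
      ∈ Set.Ioo (0 : ℝ) 1) :
    1 - ∫ x, φ x ∂(Measure.pi fun i : Fin n => gaussianReal (v i) ⟨σ ^ 2, sq_nonneg σ⟩) ≥
      Phi (PhiInv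
        (1 - ∫ x, φ x ∂(Measure.pi fun _ : Fin n => gaussianReal 0 ⟨σ ^ 2, sq_nonneg σ⟩))
        - Real.sqrt (∑ i, (v i) ^ 2) / σ) := by
  exact pi_gaussianReal_typeII_error_ge σ hσ rfl n v φ hφ hφ01 hα
end

section
/- Let σ > 0, c > 0, w ∈ ℝ, and suppose δ = Φ((c − w)/σ) − (φ_pdf((c − w)/σ)/φ_pdf(w/σ))·Φ(−w/σ). Then (1 − δ − Φ((w − c)/σ))/(1 − Φ(w/σ)) = φ_pdf((c − w)/σ)/φ_pdf(w/σ) = exp(c·(2w − c)/(2σ²)); in particular, at such a critical threshold w the epsilon lower bound ln((1 − δ − β_w)/α_w) equals c·(2w − c)/(2σ²). -/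
open MeasureTheory ProbabilityTheory Real

/-- The standard normal density `φ_pdf(x) = exp(-x²/2)/√(2π)`. -/
noncomputable def phiPdf (x : ℝ) : ℝ := Real.exp (-x ^ 2 / 2) / Real.sqrt (2 * Real.pi)

theorem one_sub_Phi (x : ℝ) : 1 - Phi x = Phi (-x) := by
  have : NullSingletonClass (gaussianReal 0 1) := nullSingletonClass_gaussianReal one_ne_zero
  have hcompl : (gaussianReal 0 1).real (Set.Iic x)ᶜ = 1 - (gaussianReal 0 1).real (Set.Iic x) :=
    probReal_compl_eq_one_sub measurableSet_Iic
  have hneg : (gaussianReal 0 1) (Set.Iic (-x)) = (gaussianReal 0 1) (Set.Ioi x) := by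
    have hmap : (gaussianReal 0 1).map (fun y : ℝ ↦ -y) = gaussianReal 0 1 := by
      rw [gaussianReal_map_neg, neg_zero]
    conv_lhs => rw [← hmap]
    rw [Measure.map_apply measurable_neg measurableSet_Iic]
    have hpre : (fun y : ℝ ↦ -y) ⁻¹' Set.Iic (-x) = Set.Ici x := by
      ext y
      simp
    rw [hpre]
    exact measure_congr Ioi_ae_eq_Ici.symm
  rw [Phi, Phi, hneg, ← Set.compl_Iic]
  exact hcompl.symm

theorem Phi_pos (x : ℝ) : 0 < Phi x := by
  refine ENNReal.toReal_pos (fun h ↦ ?_) (measure_ne_top _ _)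
  have := gaussianReal_absolutelyContinuous' 0 one_ne_zero h
  simp at this

theorem phiPdf_div_phiPdf (x y : ℝ) :
    phiPdf x / phiPdf y = Real.exp ((y ^ 2 - x ^ 2) / 2) := by
  rw [phiPdf, phiPdf, div_div_div_cancel_right₀ (by positivity), ← Real.exp_sub]
  congr 1
  ring

/-- At a critical threshold `w` satisfying
`δ = Φ((c - w)/σ) - (φ_pdf((c - w)/σ)/φ_pdf(w/σ)) Φ(-w/σ)`, one has
`(1 - δ - Φ((w - c)/σ))/(1 - Φ(w/σ)) = φ_pdf((c - w)/σ)/φ_pdf(w/σ) = exp(c(2w - c)/(2σ²))`;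
in particular the epsilon lower bound `ln((1 - δ - β_w)/α_w)` equals `c(2w - c)/(2σ²)`. -/
theorem stmt_14 (σ c w δ : ℝ) (hσ : 0 < σ) (hc : 0 < c)
    (hδ : δ = Phi ((c - w) / σ) - (phiPdf ((c - w) / σ) / phiPdf (w / σ)) * Phi (-w / σ)) :
    (1 - δ - Phi ((w - c) / σ)) / (1 - Phi (w / σ)) = phiPdf ((c - w) / σ) / phiPdf (w / σ) ∧
    phiPdf ((c - w) / σ) / phiPdf (w / σ) = Real.exp (c * (2 * w - c) / (2 * σ ^ 2)) ∧
    Real.log ((1 - δ - Phi ((w - c) / σ)) / (1 - Phi (w / σ))) =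
      c * (2 * w - c) / (2 * σ ^ 2) := by
  have hexp : phiPdf ((c - w) / σ) / phiPdf (w / σ) =
      Real.exp (c * (2 * w - c) / (2 * σ ^ 2)) := by
    rw [phiPdf_div_phiPdf]
    congr 1
    field_simp
    ring
  have hratio : (1 - δ - Phi ((w - c) / σ)) / (1 - Phi (w / σ)) =
      phiPdf ((c - w) / σ) / phiPdf (w / σ) := by
    have hsymm : 1 - Phi ((w - c) / σ) = Phi ((c - w) / σ) := by
      rw [one_sub_Phi, ← neg_div, neg_sub]
    rw [one_sub_Phi, ← neg_div, div_eq_iff (Phi_pos _).ne']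
    linarith
  exact ⟨hratio, hexp, by rw [hratio, hexp, Real.log_exp]⟩
end
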